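/- Define g(x) := -log(Σ_{n=1}^∞ e^{-nx} K(n)) for x > 0, where K is a probability distribution on the positive integers with K(n) ~ C_K n^{-(1+α)} as n → ∞ for some α ∈ (0,1) and C_K > 0. Then g is strictly increasing and continuous on (0,∞), g(x) → 0 as x → 0+, and its inverse satisfies g^{-1}(h) ~ (αh/(C_K Γ(1-α)))^{1/α} as h → 0+. -/

import Mathlib

open Filter Set

open MeasureTheory Topology

lemma hasSum_ceil_integral (G : ℕ → ℝ)
    (hG : IntegrableOn (fun t : ℝ => G ⌈t⌉₊) (Ioi 0)) :
    HasSum (fun n => G (n + 1)) (∫ t in Ioi (0 : ℝ), G ⌈t⌉₊) := by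
  have hU : (⋃ n : ℕ, Nat.ceil ⁻¹' {n + 1}) = Ioi (0 : ℝ) := by
    ext t
    simp only [mem_iUnion, mem_preimage, mem_singleton_iff, mem_Ioi]
    rw [← Nat.ceil_pos]
    constructor
    · rintro ⟨n, hn⟩
      omega
    · intro h
      exact ⟨⌈t⌉₊ - 1, by omega⟩
  have hm : ∀ n : ℕ, MeasurableSet ((Nat.ceil : ℝ → ℕ) ⁻¹' {n + 1}) := fun n =>
    Nat.measurable_ceil (measurableSet_singleton _)
  have hd : Pairwise (Function.onFun Disjoint
      (fun n : ℕ => (Nat.ceil : ℝ → ℕ) ⁻¹' {n + 1})) := by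
    intro i j hij
    refine Disjoint.preimage _ ?_
    simpa using hij
  rw [← hU] at hG
  have h := hasSum_integral_iUnion hm hd hG
  rw [hU] at h
  have hpiece : ∀ n : ℕ, ∫ t in (Nat.ceil : ℝ → ℕ) ⁻¹' {n + 1}, G ⌈t⌉₊ = G (n + 1) := by
    intro n
    rw [setIntegral_congr_fun (g := fun _ => G (n + 1)) (hm n)
      (fun t ht => by rw [mem_preimage, mem_singleton_iff] at ht; simp only [ht])]
    rw [Nat.preimage_ceil_of_ne_zero (Nat.succ_ne_zero n)]
    simp
  simpa only [hpiece] using h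

lemma hasSum_ceil_integral_scaled (G : ℕ → ℝ) {x : ℝ} (hx : 0 < x)
    (hG : IntegrableOn (fun t : ℝ => G ⌈x⁻¹ * t⌉₊) (Ioi 0)) :
    HasSum (fun n => G (n + 1)) (x⁻¹ * ∫ t in Ioi (0 : ℝ), G ⌈x⁻¹ * t⌉₊) := by
  have h := (integrableOn_Ioi_comp_mul_left_iff (fun t : ℝ => G ⌈t⌉₊) 0 (inv_pos.2 hx)).1 hG
  rw [mul_zero] at h
  convert hasSum_ceil_integral G h using 1
  rw [integral_comp_mul_left_Ioi (fun t : ℝ => G ⌈t⌉₊) 0 (inv_pos.2 hx), mul_zero, inv_inv,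
    smul_eq_mul, inv_mul_cancel_left₀ hx.ne']

lemma integrableOn_min_rpow {α : ℝ} (hα0 : 0 < α) (hα1 : α < 1) :
    IntegrableOn (fun t : ℝ => min (t ^ (-α)) (t ^ (-(1 + α)))) (Ioi 0) := by
  have hm : Measurable (fun t : ℝ => min (t ^ (-α)) (t ^ (-(1 + α)))) := by fun_prop
  rw [← Ioc_union_Ioi_eq_Ioi zero_le_one]
  refine IntegrableOn.union ?_ ?_
  · have h : IntegrableOn (fun t : ℝ => t ^ (-α)) (Ioc 0 1) :=
      (intervalIntegrable_iff_integrableOn_Ioc_of_le zero_le_one).1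
        (intervalIntegral.intervalIntegrable_rpow' (by linarith))
    refine Integrable.mono' h hm.aestronglyMeasurable ?_
    filter_upwards [ae_restrict_mem measurableSet_Ioc] with t ht
    have := ht.1
    rw [Real.norm_of_nonneg (by positivity)]
    exact min_le_left _ _
  · have h : IntegrableOn (fun t : ℝ => t ^ (-(1 + α))) (Ioi 1) :=
      integrableOn_Ioi_rpow_of_lt (by linarith) one_pos
    refine Integrable.mono' h hm.aestronglyMeasurable ?_
    filter_upwards [ae_restrict_mem measurableSet_Ioi] with t ht
    have : 0 < t := one_pos.trans ht
    rw [Real.norm_of_nonneg (by positivity)]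
    exact min_le_right _ _

lemma one_sub_exp_neg_nonneg {u : ℝ} (hu : 0 ≤ u) : 0 ≤ 1 - Real.exp (-u) := by
  have := Real.exp_le_one_iff.2 (neg_nonpos.2 hu)
  linarith

lemma one_sub_exp_neg_mul_rpow_le {α : ℝ} (hα0 : 0 < α) {t u : ℝ} (ht : 0 < t)
    (htu : t ≤ u) :
    (1 - Real.exp (-u)) * u ^ (-(1 + α)) ≤ min (t ^ (-α)) (t ^ (-(1 + α))) := by
  have hu : 0 < u := ht.trans_le htu
  have h1 : 1 - Real.exp (-u) ≤ u := by
    have := Real.add_one_le_exp (-u)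
    linarith
  have h2 : 1 - Real.exp (-u) ≤ 1 := by
    have := Real.exp_pos (-u)
    linarith
  refine le_min ?_ ?_
  · calc (1 - Real.exp (-u)) * u ^ (-(1 + α)) ≤ u * u ^ (-(1 + α)) := by gcongr
      _ = u ^ (-α) := by
        rw [show -α = 1 + -(1 + α) by ring, Real.rpow_add hu, Real.rpow_one]
      _ ≤ t ^ (-α) := Real.rpow_le_rpow_of_nonpos ht htu (by linarith)
  · calc (1 - Real.exp (-u)) * u ^ (-(1 + α)) ≤ 1 * u ^ (-(1 + α)) := by gcongr
      _ = u ^ (-(1 + α)) := one_mul _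
      _ ≤ t ^ (-(1 + α)) := Real.rpow_le_rpow_of_nonpos ht htu (by linarith)

lemma integrableOn_one_sub_exp_neg_mul_rpow {α : ℝ} (hα0 : 0 < α) (hα1 : α < 1) :
    IntegrableOn (fun t : ℝ => (1 - Real.exp (-t)) * t ^ (-(1 + α))) (Ioi 0) := by
  have hm : Measurable (fun t : ℝ => (1 - Real.exp (-t)) * t ^ (-(1 + α))) := by fun_prop
  refine Integrable.mono' (integrableOn_min_rpow hα0 hα1) hm.aestronglyMeasurable ?_
  filter_upwards [ae_restrict_mem measurableSet_Ioi] with t ht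
  have ht : 0 < t := ht
  rw [Real.norm_of_nonneg (mul_nonneg (one_sub_exp_neg_nonneg ht.le) (by positivity))]
  exact one_sub_exp_neg_mul_rpow_le hα0 ht le_rfl

lemma integral_one_sub_exp_neg_mul_rpow {α : ℝ} (hα0 : 0 < α) (hα1 : α < 1) :
    ∫ t in Ioi (0 : ℝ), (1 - Real.exp (-t)) * t ^ (-(1 + α)) = Real.Gamma (1 - α) / α := by
  have hu : ∀ t ∈ Ioi (0 : ℝ), HasDerivAt (fun t => 1 - Real.exp (-t)) (Real.exp (-t)) t := by
    intro t _
    simpa using ((hasDerivAt_neg t).exp.const_sub 1)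
  have hv : ∀ t ∈ Ioi (0 : ℝ), HasDerivAt (fun t : ℝ => -t ^ (-α) / α) (t ^ (-(1 + α))) t := by
    intro t ht
    refine (((Real.hasDerivAt_rpow_const (p := -α)
      (Or.inl (ne_of_gt ht))).neg.div_const α)).congr_deriv ?_
    rw [show -α - 1 = -(1 + α) by ring]
    field_simp
  have hΓ : IntegrableOn (fun t : ℝ => Real.exp (-t) * t ^ (-α)) (Ioi 0) := by
    convert Real.GammaIntegral_convergent (s := 1 - α) (by linarith) using 4
    ring
  have h := integral_Ioi_mul_deriv_eq_deriv_mul (a' := 0) (b' := 0) hu hv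
    (integrableOn_one_sub_exp_neg_mul_rpow hα0 hα1) ?_ ?_ ?_
  · rw [h, Real.Gamma_eq_integral (by linarith), ← integral_div, sub_zero, zero_sub, ← integral_neg]
    refine integral_congr_ae (Eventually.of_forall fun t => ?_)
    simp only
    rw [show 1 - α - 1 = -α by ring]
    ring
  · refine (hΓ.neg.div_const α).congr (Eventually.of_forall fun t => ?_)
    simp only [Pi.mul_apply, Pi.neg_apply]
    ring
  · have hlim : Tendsto (fun t : ℝ => t ^ (1 - α) / α) (𝓝[>] 0) (𝓝 0) := by
      have := ((Real.continuousAt_rpow_const 0 (1 - α) (Or.inr (by linarith))).tendsto.div_const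
        α).mono_left (nhdsWithin_le_nhds (s := Ioi 0))
      simpa [Real.zero_rpow (show (1 - α) ≠ 0 by linarith)] using this
    refine squeeze_zero_norm' ?_ hlim
    filter_upwards [self_mem_nhdsWithin] with t ht
    have ht : 0 < t := ht
    have h1 : 1 - Real.exp (-t) ≤ t := by
      have := Real.add_one_le_exp (-t)
      linarith
    rw [Pi.mul_apply, norm_mul, norm_div, norm_neg,
      Real.norm_of_nonneg (one_sub_exp_neg_nonneg ht.le), Real.norm_of_nonneg (by positivity),
      Real.norm_of_nonneg hα0.le, ← mul_div_assoc, sub_eq_add_neg 1 α, Real.rpow_add ht,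
      Real.rpow_one]
    gcongr
  · have hlim : Tendsto (fun t : ℝ => (1 - Real.exp (-t)) * (-t ^ (-α) / α)) atTop
        (𝓝 ((1 - 0) * (-0 / α))) :=
      (Real.tendsto_exp_neg_atTop_nhds_zero.const_sub 1).mul
        ((tendsto_rpow_neg_atTop hα0).neg.div_const α)
    rw [neg_zero, zero_div, mul_zero] at hlim
    exact hlim

lemma tendsto_natCeil_inv_mul_mul {t : ℝ} (ht : 0 < t) :
    Tendsto (fun x : ℝ => (⌈x⁻¹ * t⌉₊ : ℝ) * x) (𝓝[>] 0) (𝓝 t) := by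
  have hlim : Tendsto (fun x : ℝ => t + x) (𝓝[>] 0) (𝓝 t) := by
    have : Tendsto (fun x : ℝ => t + x) (𝓝 0) (𝓝 (t + 0)) := tendsto_id.const_add t
    rw [add_zero] at this
    exact this.mono_left nhdsWithin_le_nhds
  refine tendsto_of_tendsto_of_tendsto_of_le_of_le' tendsto_const_nhds hlim ?_ ?_
  · filter_upwards [self_mem_nhdsWithin] with x hx
    have hx : 0 < x := hx
    have := mul_le_mul_of_nonneg_right (Nat.le_ceil (x⁻¹ * t)) hx.le
    field_simp at this ⊢
    linarith
  · filter_upwards [self_mem_nhdsWithin] with x hx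
    have hx : 0 < x := hx
    have := mul_le_mul_of_nonneg_right
      (Nat.ceil_lt_add_one (a := x⁻¹ * t) (by positivity)).le hx.le
    rw [add_mul, one_mul, mul_right_comm, inv_mul_cancel₀ hx.ne', one_mul] at this
    exact this

/-- An Abelian theorem: a sequence with tail `K n ∼ C n ^ (-(1 + α))` satisfies
`∑ (1 - e ^ (-n x)) K n ∼ C Γ(1 - α) / α * x ^ α` as `x → 0+`. -/
lemma tendsto_tsum_one_sub_exp_mul_div_rpow {K : ℕ → ℝ} {α C : ℝ} (hα0 : 0 < α) (hα1 : α < 1)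
    (hK : Tendsto (fun n : ℕ => K n * (n : ℝ) ^ (1 + α)) atTop (𝓝 C)) :
    Tendsto (fun x : ℝ => (∑' n : ℕ, (1 - Real.exp (-(n : ℝ) * x)) * K n) / x ^ α) (𝓝[>] 0)
      (𝓝 (C * (Real.Gamma (1 - α) / α))) := by
  obtain ⟨M, hM⟩ : ∃ M, ∀ n : ℕ, ‖K n * (n : ℝ) ^ (1 + α)‖ ≤ M := by
    obtain ⟨M, hM⟩ := hK.norm.bddAbove_range
    exact ⟨M, fun n => hM ⟨n, rfl⟩⟩
  let w : ℝ → ℝ := fun u => (1 - Real.exp (-u)) * u ^ (-(1 + α))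
  let G : ℝ → ℕ → ℝ := fun x n => (K n * (n : ℝ) ^ (1 + α)) * w (n * x)
  have hmeas : ∀ x : ℝ, Measurable (fun t : ℝ => G x ⌈x⁻¹ * t⌉₊) := fun x =>
    (measurable_from_nat (f := G x)).comp (Nat.measurable_ceil.comp (measurable_const_mul _))
  have hbd : ∀ x : ℝ, 0 < x → ∀ᵐ t ∂(volume.restrict (Ioi (0 : ℝ))),
      ‖G x ⌈x⁻¹ * t⌉₊‖ ≤ M * min (t ^ (-α)) (t ^ (-(1 + α))) := by
    intro x hx
    filter_upwards [ae_restrict_mem measurableSet_Ioi] with t ht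
    have ht : 0 < t := ht
    have hle : t ≤ (⌈x⁻¹ * t⌉₊ : ℝ) * x := by
      rw [← div_le_iff₀ hx, div_eq_inv_mul]
      exact Nat.le_ceil _
    have hpos := ht.trans_le hle
    rw [norm_mul]
    refine mul_le_mul (hM _) ?_ (norm_nonneg _) ((norm_nonneg _).trans (hM 0))
    rw [Real.norm_of_nonneg (mul_nonneg (one_sub_exp_neg_nonneg hpos.le) (by positivity))]
    exact one_sub_exp_neg_mul_rpow_le hα0 ht hle
  have hint := (integrableOn_min_rpow hα0 hα1).const_mul M
  have hlim : Tendsto (fun x : ℝ => ∫ t in Ioi (0 : ℝ), G x ⌈x⁻¹ * t⌉₊) (𝓝[>] 0)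
      (𝓝 (∫ t in Ioi (0 : ℝ), C * w t)) := by
    refine tendsto_integral_filter_of_dominated_convergence _
      (Eventually.of_forall fun x => (hmeas x).aestronglyMeasurable)
      (by filter_upwards [self_mem_nhdsWithin] with x hx using hbd x hx) hint ?_
    filter_upwards [ae_restrict_mem measurableSet_Ioi] with t ht
    have ht : 0 < t := ht
    have hceil : Tendsto (fun x : ℝ => ⌈x⁻¹ * t⌉₊) (𝓝[>] 0) atTop :=
      tendsto_nat_ceil_atTop.comp (tendsto_inv_nhdsGT_zero.atTop_mul_const ht)
    have hw : ContinuousAt w t :=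
      ((by fun_prop : ContinuousAt (fun u : ℝ => 1 - Real.exp (-u)) t)).mul
        (Real.continuousAt_rpow_const _ _ (Or.inl ht.ne'))
    exact (hK.comp hceil).mul (hw.tendsto.comp (tendsto_natCeil_inv_mul_mul ht))
  rw [integral_const_mul, integral_one_sub_exp_neg_mul_rpow hα0 hα1] at hlim
  refine hlim.congr' ?_
  filter_upwards [self_mem_nhdsWithin] with x hx
  have hx : 0 < x := hx
  have hs := hasSum_ceil_integral_scaled (G x) hx
    (Integrable.mono' hint (hmeas x).aestronglyMeasurable (hbd x hx))
  have hs' := (hasSum_nat_add_iff' (f := G x) (g := x⁻¹ * ∫ t in Ioi (0 : ℝ), G x ⌈x⁻¹ * t⌉₊) 1).1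
    (by simpa [G, w] using hs)
  have heq : ∀ n : ℕ, (1 - Real.exp (-(n : ℝ) * x)) * K n = x ^ (1 + α) * G x n := by
    intro n
    rcases Nat.eq_zero_or_pos n with rfl | hn
    · simp [G, w]
    · have hn : (0 : ℝ) < n := by exact_mod_cast hn
      simp only [G, w]
      rw [Real.mul_rpow hn.le hx.le, Real.rpow_neg hn.le, Real.rpow_neg hx.le, neg_mul]
      have h1 := (Real.rpow_pos_of_pos hn (1 + α)).ne'
      have h2 := (Real.rpow_pos_of_pos hx (1 + α)).ne'
      field_simp
  simp_rw [heq]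
  rw [tsum_mul_left, hs'.tsum_eq, Real.rpow_add hx, Real.rpow_one]
  have h2 := (Real.rpow_pos_of_pos hx α).ne'
  field_simp

/-- If `g` is strictly increasing and continuous on `(0, ∞)`, tends to `0` at `0+` and satisfies
`g x ∼ A x ^ α`, then any left inverse of `g` satisfies `g⁻¹ h ∼ (h / A) ^ (1 / α)`. -/
lemma tendsto_leftInverse_div_rpow {g ginv : ℝ → ℝ} {α A : ℝ} (hα0 : 0 < α) (hA : 0 < A)
    (hmono : StrictMonoOn g (Ioi 0)) (hcont : ContinuousOn g (Ioi 0))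
    (hzero : Tendsto g (𝓝[>] 0) (𝓝 0))
    (hasymp : Tendsto (fun x => g x / x ^ α) (𝓝[>] 0) (𝓝 A))
    (hinv : ∀ x ∈ Ioi (0 : ℝ), ginv (g x) = x) :
    Tendsto (fun h => ginv h / (h / A) ^ (1 / α)) (𝓝[>] 0) (𝓝 1) := by
  have hnonneg : ∀ x, 0 < x → 0 ≤ g x := by
    intro x hx
    refine le_of_tendsto hzero ?_
    filter_upwards [Ioo_mem_nhdsGT hx] with y hy using (hmono hy.1 hx hy.2).le
  have hpos : ∀ x, 0 < x → 0 < g x := fun x hx =>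
    (hnonneg (x / 2) (by positivity)).trans_lt
      (hmono (show 0 < x / 2 by positivity) hx (by linarith))
  have hsurj : ∀ ε, 0 < ε → ∀ h ∈ Ioo 0 (g ε), ∃ x ∈ Ioo 0 ε, g x = h := by
    intro ε hε h hh
    obtain ⟨a, hga, ha⟩ := ((hzero.eventually (gt_mem_nhds hh.1)).and (Ioo_mem_nhdsGT hε)).exists
    obtain ⟨x, hx, hgx⟩ := intermediate_value_Ioo ha.2.le
      (hcont.mono fun y hy => ha.1.trans_le hy.1) ⟨hga, hh.2⟩
    exact ⟨x, ⟨ha.1.trans hx.1, hx.2⟩, hgx⟩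
  have hginv : Tendsto ginv (𝓝[>] 0) (𝓝[>] 0) := by
    refine (nhdsGT_basis (0 : ℝ)).tendsto_right_iff.2 fun ε hε => ?_
    filter_upwards [Ioo_mem_nhdsGT (hpos ε hε)] with h hh
    obtain ⟨x, hx, rfl⟩ := hsurj ε hε h hh
    rwa [hinv x hx.1]
  have hlim : Tendsto (fun x => ((g x / x ^ α / A) ^ (1 / α))⁻¹) (𝓝[>] 0) (𝓝 1) := by
    have h1 : Tendsto (fun x => g x / x ^ α / A) (𝓝[>] 0) (𝓝 1) := by
      simpa [hA.ne'] using hasymp.div_const A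
    simpa using (h1.rpow_const (p := 1 / α) (Or.inl one_ne_zero)).inv₀ (by simp)
  refine (hlim.comp hginv).congr' ?_
  filter_upwards [Ioo_mem_nhdsGT (hpos 1 one_pos)] with h hh
  obtain ⟨x, hx, rfl⟩ := hsurj 1 one_pos h hh
  have hx0 : 0 < x := hx.1
  have hg := hpos x hx0
  rw [Function.comp_apply, hinv x hx0, div_right_comm, Real.div_rpow (by positivity) (by positivity),
    ← Real.rpow_mul hx0.le, mul_one_div_cancel hα0.ne', Real.rpow_one, inv_div]

/-- Properties of `g(x) = -log Σ_n e^{-nx} K(n)` for a probability mass function `K`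
on the positive integers with `K(n) ~ C_K n^{-(1+α)}`: `g` is strictly increasing and
continuous on `(0,∞)`, `g(x) → 0` as `x → 0+`, and its inverse satisfies
`g⁻¹(h) ~ (α h / (C_K Γ(1-α)))^{1/α}` as `h → 0+`. -/
theorem homogeneous_free_energy_asymptotics
    (K : ℕ → ℝ) (hKnonneg : ∀ n, 0 ≤ K n) (hK0 : K 0 = 0)
    (hKsum : ∑' n, K n = 1)
    (α : ℝ) (hα0 : 0 < α) (hα1 : α < 1) (CK : ℝ) (hCK : 0 < CK)
    (hKtail : Tendsto (fun n : ℕ => K n * (n : ℝ) ^ (1 + α)) atTop (nhds CK))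
    (g : ℝ → ℝ)
    (hg : ∀ x, g x = -Real.log (∑' n : ℕ, Real.exp (-(n : ℝ) * x) * K n)) :
    StrictMonoOn g (Ioi 0) ∧ ContinuousOn g (Ioi 0) ∧
      Tendsto g (nhdsWithin 0 (Ioi 0)) (nhds 0) ∧
      ∀ ginv : ℝ → ℝ, (∀ x ∈ Ioi (0:ℝ), ginv (g x) = x) →
        Tendsto (fun h => ginv h / (α * h / (CK * Real.Gamma (1 - α))) ^ (1 / α))
          (nhdsWithin 0 (Ioi 0)) (nhds 1) := by
  have hsumm : Summable K := by
    by_contra h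
    rw [tsum_eq_zero_of_not_summable h] at hKsum
    exact zero_ne_one hKsum
  set φ : ℝ → ℝ := fun x => ∑' n : ℕ, Real.exp (-(n : ℝ) * x) * K n with hφ
  have hle : ∀ (n : ℕ), ∀ x ∈ Ici (0 : ℝ), ‖Real.exp (-(n : ℝ) * x) * K n‖ ≤ K n := by
    intro n x hx
    have hx : 0 ≤ x := hx
    rw [Real.norm_of_nonneg (mul_nonneg (Real.exp_pos _).le (hKnonneg n))]
    refine mul_le_of_le_one_left (hKnonneg n) (Real.exp_le_one_iff.2 ?_)
    have : 0 ≤ (n : ℝ) * x := by positivity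
    linarith
  have hsum : ∀ x ∈ Ici (0 : ℝ), Summable (fun n : ℕ => Real.exp (-(n : ℝ) * x) * K n) :=
    fun x hx => Summable.of_norm_bounded hsumm fun n => hle n x hx
  have hφcont : ContinuousOn φ (Ici 0) :=
    continuousOn_tsum (fun n => by fun_prop) hsumm hle
  obtain ⟨m, hm⟩ : ∃ m, 0 < K m := by
    by_contra! h
    have : K = 0 := funext fun n => le_antisymm (h n) (hKnonneg n)
    simp [this] at hKsum
  have hm0 : (0 : ℝ) < m := by
    rcases Nat.eq_zero_or_pos m with rfl | h
    · exact absurd hK0 hm.ne'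
    · exact_mod_cast h
  have hφpos : ∀ x ∈ Ici (0 : ℝ), 0 < φ x := fun x hx =>
    (hsum x hx).tsum_pos (fun n => mul_nonneg (Real.exp_pos _).le (hKnonneg n)) m (by positivity)
  have hφanti : StrictAntiOn φ (Ici 0) := by
    intro x hx y hy hxy
    refine Summable.tsum_lt_tsum (i := m) (fun n => ?_) ?_ (hsum y hy) (hsum x hx)
    · refine mul_le_mul_of_nonneg_right (Real.exp_le_exp.2 ?_) (hKnonneg n)
      nlinarith [(Nat.cast_nonneg n : (0 : ℝ) ≤ n)]
    · refine mul_lt_mul_of_pos_right (Real.exp_lt_exp.2 ?_) hm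
      nlinarith
  have hφ0 : φ 0 = 1 := by simpa [hφ] using hKsum
  have hg' : g = fun x => -Real.log (φ x) := funext hg
  have hgcont : ContinuousOn g (Ici 0) := by
    rw [hg']
    exact (hφcont.log fun x hx => (hφpos x hx).ne').neg
  have hmono : StrictMonoOn g (Ioi 0) := by
    intro x hx y hy hxy
    rw [hg']
    exact neg_lt_neg (Real.log_lt_log (hφpos y (Ioi_subset_Ici_self hy))
      (hφanti (Ioi_subset_Ici_self hx) (Ioi_subset_Ici_self hy) hxy))
  have hzero : Tendsto g (𝓝[>] 0) (𝓝 0) := by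
    have h := (hgcont 0 self_mem_Ici).tendsto.mono_left (nhdsWithin_mono 0 Ioi_subset_Ici_self)
    rwa [show g 0 = 0 by rw [hg']; simp [hφ0]] at h
  refine ⟨hmono, hgcont.mono Ioi_subset_Ici_self, hzero, fun ginv hinv => ?_⟩
  have hD : Tendsto (fun x => (1 - φ x) / x ^ α) (𝓝[>] 0)
      (𝓝 (CK * (Real.Gamma (1 - α) / α))) := by
    refine (tendsto_tsum_one_sub_exp_mul_div_rpow hα0 hα1 hKtail).congr' ?_
    filter_upwards [self_mem_nhdsWithin] with x hx
    simp only [sub_mul, one_mul]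
    rw [hsumm.tsum_sub (hsum x (Ioi_subset_Ici_self hx)), hKsum]
  have hφlim : Tendsto φ (𝓝[>] 0) (𝓝[≠] 1) := by
    refine tendsto_nhdsWithin_iff.2 ⟨?_, ?_⟩
    · rw [← hφ0]
      exact (hφcont 0 self_mem_Ici).tendsto.mono_left (nhdsWithin_mono 0 Ioi_subset_Ici_self)
    · filter_upwards [self_mem_nhdsWithin] with x hx
      rw [← hφ0]
      exact (hφanti self_mem_Ici (Ioi_subset_Ici_self hx) hx).ne
  have hlog : Tendsto (fun x => slope Real.log 1 (φ x)) (𝓝[>] 0) (𝓝 1) := by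
    have := (hasDerivAt_iff_tendsto_slope.1 (Real.hasDerivAt_log one_ne_zero)).comp hφlim
    rwa [inv_one] at this
  have hasymp : Tendsto (fun x => g x / x ^ α) (𝓝[>] 0)
      (𝓝 (CK * (Real.Gamma (1 - α) / α))) := by
    have h := hlog.mul hD
    rw [one_mul] at h
    refine h.congr' ?_
    filter_upwards [hφlim.eventually self_mem_nhdsWithin] with x hx
    have hx : φ x - 1 ≠ 0 := sub_ne_zero.2 hx
    rw [slope_def_field, Real.log_one, hg']
    field_simp
    ring
  have hΓ : 0 < Real.Gamma (1 - α) := Real.Gamma_pos_of_pos (by linarith)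
  have hA : 0 < CK * (Real.Gamma (1 - α) / α) := by positivity
  convert tendsto_leftInverse_div_rpow hα0 hA hmono (hgcont.mono Ioi_subset_Ici_self) hzero hasymp
    hinv using 4 with h
  field_simp
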